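/- Let n ≥ 1 and d ≥ 1 be integers and let f be a real polynomial in n variables of total degree at most d that is nonnegative on [−1,1]^n. Let r be a positive integer such that n divides r and r/log₂ r ≥ 540·n²·d². Then there exists a real polynomial p in n variables that is a finite sum of squares of real polynomials and has total degree at most r, such that ‖p − f‖_{1,cheb} ≤ 70458 · n³ · d² · ‖f‖_{1,cheb} · (log₂ r)³ / r². -/

import Mathlib

open Polynomial

/-- The k-th Chebyshev polynomial of the first kind over ℝ. -/
noncomputable def chebT (k : ℕ) : Polynomial ℝ := Polynomial.Chebyshev.T ℝ (k : ℤ)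

/-- The multivariate (tensor) Chebyshev polynomial `T_α(x) = ∏ᵢ T_{αᵢ}(xᵢ)`. -/
noncomputable def mvChebT (n : ℕ) (α : Fin n → ℕ) : MvPolynomial (Fin n) ℝ :=
  ∏ i, Polynomial.aeval (MvPolynomial.X i) (chebT (α i))

/-- The Chebyshev 1-norm of an n-variate real polynomial: the sum of the absolute values
of the coefficients in the (unique) expansion in the tensor Chebyshev basis. -/
noncomputable def mvCheb1Norm {n : ℕ} (p : MvPolynomial (Fin n) ℝ) : ℝ :=
  sInf {s : ℝ | ∃ c : (Fin n → ℕ) →₀ ℝ,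
    p = c.sum (fun α coef => MvPolynomial.C coef * mvChebT n α) ∧
    s = c.sum (fun _ coef => |coef|)}

/-- An n-variate real polynomial is a sum of squares if it is a finite sum of squares
of real polynomials. -/
def IsSOS {n : ℕ} (p : MvPolynomial (Fin n) ℝ) : Prop :=
  ∃ (s : ℕ) (h : Fin s → MvPolynomial (Fin n) ℝ), p = ∑ i, (h i) ^ 2

section L1Bound

variable {ι V : Type*} [AddCommGroup V] [Module ℝ V]

/-- `v` is a finite linear combination of the family `T` whose coefficients have absolute
values summing to at most `s`. -/
def L1Bound (T : ι → V) (v : V) (s : ℝ) : Prop :=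
  ∃ c : ι →₀ ℝ, Finsupp.linearCombination ℝ T c = v ∧ c.sum (fun _ a => |a|) ≤ s

variable {T : ι → V} {v w : V} {s t : ℝ}

theorem L1Bound.mono (h : L1Bound T v s) (hst : s ≤ t) : L1Bound T v t := by
  obtain ⟨c, hc, hs⟩ := h
  exact ⟨c, hc, hs.trans hst⟩

theorem L1Bound.congr (h : L1Bound T v s) (hvw : v = w) (hst : s ≤ t) : L1Bound T w t :=
  hvw ▸ h.mono hst

theorem L1Bound.zero : L1Bound T 0 0 := ⟨0, by simp, by simp⟩

theorem L1Bound.basis (i : ι) : L1Bound T (T i) 1 :=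
  ⟨Finsupp.single i 1, by simp, by simp⟩

theorem L1Bound.nonneg (h : L1Bound T v s) : 0 ≤ s := by
  obtain ⟨c, -, hs⟩ := h
  exact (Finset.sum_nonneg fun i _ => abs_nonneg (c i)).trans hs

theorem L1Bound.add (hv : L1Bound T v s) (hw : L1Bound T w t) : L1Bound T (v + w) (s + t) := by
  classical
  obtain ⟨c, hc, hs⟩ := hv
  obtain ⟨e, he, ht⟩ := hw
  refine ⟨c + e, by rw [map_add, hc, he], ?_⟩
  have h0 : ∀ i : ι, |(0 : ℝ)| = 0 := fun _ => abs_zero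
  rw [Finsupp.sum_of_support_subset _ Finsupp.support_add _ fun i _ => h0 i]
  rw [Finsupp.sum_of_support_subset _ (Finset.subset_union_left (s₂ := e.support)) _
    fun i _ => h0 i] at hs
  rw [Finsupp.sum_of_support_subset _ (Finset.subset_union_right (s₁ := c.support)) _
    fun i _ => h0 i] at ht
  calc _ ≤ ∑ i ∈ c.support ∪ e.support, (|c i| + |e i|) :=
        Finset.sum_le_sum fun i _ => abs_add_le _ _
    _ ≤ s + t := by rw [Finset.sum_add_distrib]; exact add_le_add hs ht

theorem L1Bound.smul (a : ℝ) (hv : L1Bound T v s) : L1Bound T (a • v) (|a| * s) := by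
  obtain ⟨c, hc, hs⟩ := hv
  refine ⟨a • c, by rw [map_smul, hc], ?_⟩
  rw [Finsupp.sum_of_support_subset _ (Finsupp.support_smul) _ (by simp)]
  simp only [Finsupp.smul_apply, smul_eq_mul, abs_mul]
  rw [← Finset.mul_sum]
  exact mul_le_mul_of_nonneg_left hs (abs_nonneg a)

theorem L1Bound.neg (hv : L1Bound T v s) : L1Bound T (-v) s := by
  simpa using hv.smul (-1)

theorem L1Bound.sub (hv : L1Bound T v s) (hw : L1Bound T w t) : L1Bound T (v - w) (s + t) := by
  simpa [sub_eq_add_neg] using hv.add hw.neg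

theorem L1Bound.sum {κ : Type*} (S : Finset κ) {v : κ → V} {s : κ → ℝ}
    (h : ∀ k ∈ S, L1Bound T (v k) (s k)) : L1Bound T (∑ k ∈ S, v k) (∑ k ∈ S, s k) := by
  classical
  induction S using Finset.induction_on with
  | empty => simpa using L1Bound.zero
  | insert a S ha ih =>
    rw [Finset.sum_insert ha, Finset.sum_insert ha]
    exact (h a (by simp)).add (ih fun k hk => h k (by simp [hk]))

end L1Bound

section Univariate

theorem l1Bound_T (k : ℤ) : L1Bound chebT (Chebyshev.T ℝ k) 1 := by
  rw [← Chebyshev.T_natAbs]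
  exact L1Bound.basis (T := chebT) k.natAbs

theorem l1Bound_T_mul_T (k l : ℤ) :
    L1Bound chebT (Chebyshev.T ℝ k * Chebyshev.T ℝ l) 1 := by
  have h : Chebyshev.T ℝ k * Chebyshev.T ℝ l =
      (1 / 2 : ℝ) • (Chebyshev.T ℝ (k + l) + Chebyshev.T ℝ (k - l)) := by
    rw [← Chebyshev.T_mul_T, mul_assoc, ← C_ofNat, ← smul_eq_C_mul, smul_smul]
    norm_num
  rw [h]
  exact (((l1Bound_T (k + l)).add (l1Bound_T (k - l))).smul (1 / 2)).mono (by norm_num [abs_of_pos])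

theorem L1Bound.mul {P Q : ℝ[X]} {s t : ℝ} (hP : L1Bound chebT P s) (hQ : L1Bound chebT Q t) :
    L1Bound chebT (P * Q) (s * t) := by
  have ht := hQ.nonneg
  obtain ⟨c, rfl, hs⟩ := hP
  obtain ⟨e, rfl, ht'⟩ := hQ
  have h : Finsupp.linearCombination ℝ chebT c * Finsupp.linearCombination ℝ chebT e =
      ∑ i ∈ c.support, ∑ j ∈ e.support, (c i * e j) • (chebT i * chebT j) := by
    simp only [Finsupp.linearCombination_apply, Finsupp.sum, Finset.sum_mul_sum, smul_mul_smul_comm]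
  rw [h]
  have hb := L1Bound.sum (T := chebT) c.support (fun i _ => L1Bound.sum e.support
    (fun j _ => (l1Bound_T_mul_T i j).smul (c i * e j)))
  refine hb.mono ?_
  simp only [abs_mul, mul_one, ← Finset.sum_mul_sum]
  exact mul_le_mul hs ht' (Finset.sum_nonneg fun i _ => abs_nonneg _) (hs.trans' <| Finset.sum_nonneg fun i _ => abs_nonneg _)

theorem l1Bound_U (k : ℕ) : L1Bound chebT (Chebyshev.U ℝ k) (k + 1) := by
  induction k using Nat.twoStepInduction with
  | zero => simpa using l1Bound_T 0
  | one => 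
    have := (l1Bound_T 1).add (l1Bound_T 1)
    convert this using 1 <;> simp [Chebyshev.U_one]
    ring
  | more k ih _ =>
    have h := ((l1Bound_T (k + 2)).add (l1Bound_T (k + 2))).add ih
    have e := Chebyshev.U_eq_two_mul_T_add_U ℝ (k : ℤ)
    push_cast
    rw [e]
    refine h.congr (by rw [two_mul]) (by linarith)

theorem l1Bound_dilate_aux {ρ : ℝ} (hρ : ρ ≤ 1) (k : ℕ)
    (hB : ∀ j ≤ k, L1Bound chebT ((Chebyshev.T ℝ j).comp (C ρ * X)) 2) (i : ℕ) :
    L1Bound chebT (Chebyshev.U ℝ i * (Chebyshev.T ℝ (k + 1)).comp (C ρ * X)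
        - Chebyshev.U ℝ (i - 1) * (Chebyshev.T ℝ k).comp (C ρ * X) - Chebyshev.T ℝ (i + k + 1))
      (2 * (1 - ρ) * ((i + k + 1) * (i + k + 2) - i * (i + 1))) := by
  have habs : |-(1 - ρ)| = 1 - ρ := by rw [abs_neg, abs_of_nonneg (by linarith)]
  induction k generalizing i with
  | zero =>
    have h := ((l1Bound_T 1).mul (l1Bound_U i)).smul (-(1 - ρ))
    refine h.congr ?_ ?_
    · have := Chebyshev.T_eq_X_mul_U_sub_U ℝ (i - 1)
      have e1 : (i : ℤ) - 1 + 2 = i + 1 := by ring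
      have e2 : (i : ℤ) - 1 + 1 = i := by ring
      rw [e1, e2] at this
      simp [this, smul_eq_C_mul, Chebyshev.T_one]
      ring
    · rw [habs]
      push_cast
      nlinarith [mul_nonneg (sub_nonneg.2 hρ) (Nat.cast_nonneg (α := ℝ) i)]
  | succ k ih =>
    have h := (((l1Bound_T 1).mul (l1Bound_U i)).mul (hB (k + 1) le_rfl)).smul (-2 * (1 - ρ))
    have h2 := (ih (fun j hj => hB j (by omega)) (i + 1)).add h
    have habs2 : |-2 * (1 - ρ)| = 2 * (1 - ρ) := by
      rw [abs_mul, abs_of_nonneg (by linarith : 0 ≤ 1 - ρ)]; norm_num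
    refine h2.congr ?_ ?_
    · have e3 : ((k + 1 : ℕ) : ℤ) + 1 = k + 2 := by push_cast; ring
      have e4 : ((i + 1 : ℕ) : ℤ) = i + 1 := by push_cast; ring
      rw [e3, e4, Chebyshev.T_add_two ℝ k, Chebyshev.U_add_one ℝ i, show (i : ℤ) + (k + 1 : ℕ) + 1 = i + 1 + k + 1 by push_cast; ring]
      simp [smul_eq_C_mul, Chebyshev.T_one]
      simp only [C_ofNat]
      ring
    · rw [habs2]
      push_cast
      nlinarith [hρ]

/-- The substitution `x ↦ ρ x` moves `T_k` by at most `4 (1 - ρ) k ^ 2` in the Chebyshev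
norm as long as `4 (1 - ρ) k ^ 2 ≤ 1`. -/
theorem l1Bound_dilate {ρ : ℝ} (hρ : ρ ≤ 1) (k : ℕ) (hk : 4 * (1 - ρ) * k ^ 2 ≤ 1) :
    L1Bound chebT ((Chebyshev.T ℝ k).comp (C ρ * X) - Chebyshev.T ℝ k) (4 * (1 - ρ) * k ^ 2) := by
  induction k using Nat.strong_induction_on with
  | _ k ih =>
  have hρ' : 0 ≤ 1 - ρ := by linarith
  rcases k with _ | k
  · simpa using L1Bound.zero (T := chebT)
  · have hB : ∀ j ≤ k, L1Bound chebT ((Chebyshev.T ℝ j).comp (C ρ * X)) 2 := by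
      intro j hj
      have hjk : (j : ℝ) ≤ ((k + 1 : ℕ) : ℝ) := by exact_mod_cast (by omega : j ≤ k + 1)
      have hle : 4 * (1 - ρ) * (j : ℝ) ^ 2 ≤ 1 := hk.trans' (by gcongr)
      have := (ih j (by omega) hle).add (l1Bound_T j)
      rw [sub_add_cancel] at this
      exact this.mono (by linarith)
    have h := l1Bound_dilate_aux hρ k hB 0
    refine h.congr ?_ ?_
    · simp
    · push_cast
      have : (0 : ℝ) ≤ k := Nat.cast_nonneg k
      nlinarith [mul_nonneg hρ' this, mul_nonneg hρ' (mul_nonneg this this)]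

end Univariate

section Quadrature

/-- The equispaced angles `2πi/N`. -/
noncomputable def equiAngle (N i : ℕ) : ℝ := 2 * Real.pi * i / N

theorem sum_cos_equiAngle (N : ℕ) (hN : 0 < N) (h : ℤ) (hlt : |h| < N) :
    ∑ i ∈ Finset.range N, Real.cos (h * equiAngle N i) = if h = 0 then (N : ℝ) else 0 := by
  have hN' : (0 : ℝ) < N := by exact_mod_cast hN
  split_ifs with h0
  · simp [h0]
  · have hs : Real.sin (h * Real.pi / N) ≠ 0 := by
      rw [Ne, Real.sin_eq_zero_iff]
      rintro ⟨k, hk⟩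
      have h1 : (k : ℝ) * N = h := by
        field_simp at hk
        nlinarith [Real.pi_pos]
      have h2 : k * N = h := by exact_mod_cast h1
      have hk0 : k ≠ 0 := by rintro rfl; exact h0 (by simpa using h2.symm)
      have : (N : ℤ) ≤ |h| := by
        rw [← h2, abs_mul, abs_of_nonneg (by positivity : (0 : ℤ) ≤ N)]
        have := Int.one_le_abs hk0
        nlinarith [(by positivity : (0 : ℤ) ≤ N)]
      omega
    have key : ∀ n : ℕ, 2 * Real.sin (h * Real.pi / N) *
        ∑ i ∈ Finset.range n, Real.cos (h * equiAngle N i) =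
        Real.sin (h * Real.pi * (2 * n - 1) / N) + Real.sin (h * Real.pi / N) := by
      intro n
      induction n with
      | zero =>
        rw [show (h * Real.pi * (2 * ((0 : ℕ) : ℝ) - 1) / N : ℝ) = -(h * Real.pi / N) by
          push_cast; ring]
        simp
      | succ n ih =>
        rw [Finset.sum_range_succ, mul_add, ih, equiAngle]
        have e1 : (h * Real.pi * (2 * ((n + 1 : ℕ) : ℝ) - 1) / N : ℝ) =
          h * (2 * Real.pi * n / N) + h * Real.pi / N := by push_cast; field_simp; ring
        have e2 : (h * Real.pi * (2 * (n : ℝ) - 1) / N : ℝ) =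
          h * (2 * Real.pi * n / N) - h * Real.pi / N := by field_simp
        rw [e1, e2, Real.sin_add, Real.sin_sub]
        ring
    have hN1 := key N
    have e : (h * Real.pi * (2 * (N : ℝ) - 1) / N : ℝ) = -(h * Real.pi / N) + h * (2 * Real.pi) := by
      field_simp; ring
    rw [e, Real.sin_add_int_mul_two_pi, Real.sin_neg, neg_add_cancel] at hN1
    simpa [hs] using hN1

theorem sum_cos_mul_cos_equiAngle (N : ℕ) (k l : ℤ) (hlt : |k| + |l| < N) :
    ∑ i ∈ Finset.range N, Real.cos (k * equiAngle N i) * Real.cos (l * equiAngle N i) =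
      N / 2 * ((if k = l then 1 else 0) + if k = -l then 1 else 0) := by
  have hN : 0 < N := by
    have := abs_nonneg k; have := abs_nonneg l; omega
  have h1 := sum_cos_equiAngle N hN (k - l) ((abs_sub _ _).trans_lt hlt)
  have h2 := sum_cos_equiAngle N hN (k + l) ((abs_add_le _ _).trans_lt hlt)
  have : ∀ i ∈ Finset.range N, Real.cos (k * equiAngle N i) * Real.cos (l * equiAngle N i) =
      1 / 2 * (Real.cos ((k - l : ℤ) * equiAngle N i) + Real.cos ((k + l : ℤ) * equiAngle N i)) := by
    intro i _
    push_cast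
    rw [sub_mul, add_mul, Real.cos_sub, Real.cos_add]
    ring
  rw [Finset.sum_congr rfl this, ← Finset.mul_sum, Finset.sum_add_distrib, h1, h2]
  simp only [sub_eq_zero, add_eq_zero_iff_eq_neg]
  split_ifs <;> ring

theorem sum_cos_mul_cos_equiAngle_nat (N k l : ℕ) (hlt : k + l < N) :
    ∑ i ∈ Finset.range N, Real.cos (k * equiAngle N i) * Real.cos (l * equiAngle N i) =
      if k = l then (if k = 0 then (N : ℝ) else N / 2) else 0 := by
  have := sum_cos_mul_cos_equiAngle N k l (by simp; omega)
  push_cast at this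
  rw [this]
  by_cases h : k = l
  · subst h
    by_cases h0 : k = 0
    · simp [h0]
      ring
    · have : ¬ ((k : ℤ) = -k) := by omega
      simp [h0]
  · have : ¬ ((k : ℤ) = -l) := by omega
    simp [h, this]

theorem chebT_eval_cos (k : ℕ) (θ : ℝ) : (chebT k).eval (Real.cos θ) = Real.cos (k * θ) := by
  simp [chebT]

theorem exists_sum_smul_of_mem_span_image {ι V : Type*} [AddCommGroup V] [Module ℝ V] {T : ι → V}
    {S : Finset ι} {v : V} (h : v ∈ Submodule.span ℝ (T '' S)) :
    ∃ c : ι → ℝ, v = ∑ j ∈ S, c j • T j := by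
  rw [Finsupp.mem_span_image_iff_linearCombination] at h
  obtain ⟨c, hc, rfl⟩ := h
  exact ⟨c, Finsupp.sum_of_support_subset c (by exact_mod_cast hc) _ (by simp)⟩

theorem exists_chebT_expansion_X_pow (k : ℕ) :
    ∃ c : ℕ → ℝ, (X ^ k : ℝ[X]) = ∑ j ∈ Finset.range (k + 1), c j • chebT j := by
  suffices h : (X ^ k : ℝ[X]) ∈ Submodule.span ℝ (chebT '' ↑(Finset.range (k + 1))) by
    exact exists_sum_smul_of_mem_span_image h
  induction k with
  | zero => exact Submodule.subset_span ⟨0, by simp, by simp [chebT]⟩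
  | succ k ih =>
    rw [pow_succ']
    have hle : Submodule.span ℝ (chebT '' ↑(Finset.range (k + 1))) ≤
        (Submodule.span ℝ (chebT '' ↑(Finset.range (k + 1 + 1)))).comap
          (LinearMap.mulLeft ℝ X) := by
      rw [Submodule.span_le]
      rintro _ ⟨j, hj, rfl⟩
      simp only [Finset.coe_range, Set.mem_Iio] at hj
      simp only [SetLike.mem_coe, Submodule.mem_comap, LinearMap.mulLeft_apply]
      rcases j with _ | j
      · exact Submodule.subset_span ⟨1, by simp, by simp [chebT]⟩
      · have e : X * chebT (j + 1) = (1 / 2 : ℝ) • (chebT (j + 2) + chebT j) := by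
          have := Chebyshev.T_add_two ℝ j
          simp only [chebT]
          push_cast
          rw [this, sub_add_cancel, mul_assoc, ← C_ofNat, ← smul_eq_C_mul, smul_smul]
          norm_num
        rw [e]
        refine Submodule.smul_mem _ _ (Submodule.add_mem _ ?_ ?_)
        · exact Submodule.subset_span ⟨j + 2, by simp; omega, rfl⟩
        · exact Submodule.subset_span ⟨j, by simp; omega, rfl⟩
    exact hle ih

theorem exists_chebT_expansion (P : ℝ[X]) {D : ℕ} (hP : P.natDegree ≤ D) :
    ∃ c : ℕ → ℝ, P = ∑ j ∈ Finset.range (D + 1), c j • chebT j := by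
  suffices h : P ∈ Submodule.span ℝ (chebT '' ↑(Finset.range (D + 1))) by
    exact exists_sum_smul_of_mem_span_image h
  rw [P.as_sum_range_C_mul_X_pow]
  refine Submodule.sum_mem _ fun k hk => ?_
  rw [← smul_eq_C_mul]
  refine Submodule.smul_mem _ _ ?_
  obtain ⟨c, hc⟩ := exists_chebT_expansion_X_pow k
  rw [hc]
  refine Submodule.sum_mem _ fun j hj => Submodule.smul_mem _ _ (Submodule.subset_span ⟨j, ?_, rfl⟩)
  simp only [Finset.mem_range, Finset.coe_range, Set.mem_Iio] at *
  omega

theorem l1Bound_of_abs_eval_le (P : ℝ[X]) {D : ℕ} (hP : P.natDegree ≤ D) {B : ℝ}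
    (hB : ∀ θ : ℝ, |P.eval (Real.cos θ)| ≤ B) : L1Bound chebT P (2 * (D + 1) * B) := by
  have hB0 : 0 ≤ B := (abs_nonneg _).trans (hB 0)
  obtain ⟨c, hc⟩ := exists_chebT_expansion P hP
  have hcoef : ∀ k ∈ Finset.range (D + 1), |c k| ≤ 2 * B := by
    intro k hk
    rw [Finset.mem_range] at hk
    set N := 2 * D + 1 with hN
    have hNpos : (0 : ℝ) < N := by positivity
    have h1 : ∑ i ∈ Finset.range N, Real.cos (k * equiAngle N i) *
        P.eval (Real.cos (equiAngle N i)) = c k * if k = 0 then (N : ℝ) else N / 2 := by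
      conv_lhs => rw [hc]
      simp only [eval_finsetSum, eval_smul, chebT_eval_cos, smul_eq_mul, Finset.mul_sum]
      rw [Finset.sum_comm, Finset.sum_eq_single_of_mem k (by simpa using hk)]
      · simp only [mul_left_comm _ (c _)]
        rw [← Finset.mul_sum, sum_cos_mul_cos_equiAngle_nat N k k (by omega)]
        simp
      · intro j hj hjk
        rw [Finset.mem_range] at hj
        simp only [mul_left_comm _ (c _)]
        rw [← Finset.mul_sum, sum_cos_mul_cos_equiAngle_nat N k j (by omega)]
        simp [Ne.symm hjk]
    have h2 : |∑ i ∈ Finset.range N, Real.cos (k * equiAngle N i) *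
        P.eval (Real.cos (equiAngle N i))| ≤ N * B := by
      refine (Finset.abs_sum_le_sum_abs _ _).trans ?_
      refine (Finset.sum_le_sum (g := fun _ => B) fun i _ => ?_).trans (by simp)
      rw [abs_mul]
      exact (mul_le_mul (Real.abs_cos_le_one _) (hB _) (abs_nonneg _) zero_le_one).trans (by simp)
    have h3 : (N : ℝ) / 2 ≤ if k = 0 then (N : ℝ) else N / 2 := by split_ifs <;> linarith
    rw [h1, abs_mul, abs_of_nonneg (h3.trans' (by positivity))] at h2
    have h4 : |c k| * (N / 2) ≤ N * B :=
      (mul_le_mul_of_nonneg_left h3 (abs_nonneg _)).trans h2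
    nlinarith
  rw [hc]
  refine (L1Bound.sum _ fun j _ => (L1Bound.basis (T := chebT) j).smul (c j)).mono ?_
  simp only [mul_one]
  refine (Finset.sum_le_sum hcoef).trans_eq ?_
  simp
  ring

end Quadrature

section Multivariate

variable {n : ℕ}

theorem eval_mvChebT (α : Fin n → ℕ) (x : Fin n → ℝ) :
    MvPolynomial.eval x (mvChebT n α) = ∏ i, (chebT (α i)).eval (x i) := by
  simp only [mvChebT, map_prod]
  refine Finset.prod_congr rfl fun i _ => ?_
  rw [← MvPolynomial.coe_aeval_eq_eval]
  simp only [RingHom.coe_coe]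
  rw [← Polynomial.aeval_algHom_apply, MvPolynomial.aeval_X]
  simp

theorem eval_mvChebT_cos (α : Fin n → ℕ) (θ : Fin n → ℝ) :
    MvPolynomial.eval (fun i => Real.cos (θ i)) (mvChebT n α) = ∏ i, Real.cos (α i * θ i) := by
  simp only [eval_mvChebT, chebT_eval_cos]

theorem linearIndependent_mvChebT : LinearIndependent ℝ (mvChebT n) := by
  rw [linearIndependent_iff']
  intro S c hc β hβ
  set N := 2 * (S.sup fun α => Finset.univ.sup α) + 1 with hN
  have hle : ∀ α ∈ S, ∀ i, α i ≤ S.sup fun α => Finset.univ.sup α := fun α hα i =>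
    (Finset.le_sup (f := α) (Finset.mem_univ i)).trans
      (Finset.le_sup (f := fun α : Fin n → ℕ => Finset.univ.sup α) hα)
  have h0 : ∑ ν : Fin n → Fin N, (∏ i, Real.cos (β i * equiAngle N (ν i))) *
      MvPolynomial.eval (fun i => Real.cos (equiAngle N (ν i))) (∑ α ∈ S, c α • mvChebT n α) = 0 := by
    simp [hc]
  have hprod : ∀ α ∈ S, ∑ ν : Fin n → Fin N, (∏ i, Real.cos (β i * equiAngle N (ν i))) *
      (∏ i, Real.cos (α i * equiAngle N (ν i))) =
      ∏ i, if β i = α i then (if β i = 0 then (N : ℝ) else N / 2) else 0 := by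
    intro α hα
    simp only [← Finset.prod_mul_distrib]
    rw [← Fintype.prod_sum (fun i (j : Fin N) => Real.cos (β i * equiAngle N j) *
      Real.cos (α i * equiAngle N j))]
    refine Finset.prod_congr rfl fun i _ => ?_
    rw [Fin.sum_univ_eq_sum_range (fun j => Real.cos (β i * equiAngle N j) *
      Real.cos (α i * equiAngle N j)), sum_cos_mul_cos_equiAngle_nat]
    have := hle β hβ i
    have := hle α hα i
    omega
  simp only [map_sum, MvPolynomial.smul_eval, eval_mvChebT_cos, Finset.mul_sum,
    mul_left_comm _ (c _)] at h0
  rw [Finset.sum_comm] at h0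
  simp only [← Finset.mul_sum] at h0
  rw [Finset.sum_eq_single_of_mem β hβ, hprod β hβ] at h0
  · refine (mul_eq_zero.1 h0).resolve_right (Finset.prod_ne_zero_iff.2 fun i _ => ?_)
    have : (N : ℝ) ≠ 0 := by positivity
    split_ifs <;> simp_all
  · intro α hα hne
    rw [hprod α hα]
    obtain ⟨i, hi⟩ := Function.ne_iff.1 hne
    rw [Finset.prod_eq_zero (Finset.mem_univ i), mul_zero]
    rw [if_neg (Ne.symm hi)]

theorem linearCombination_mvChebT (c : (Fin n → ℕ) →₀ ℝ) :
    Finsupp.linearCombination ℝ (mvChebT n) c =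
      c.sum fun α coef => MvPolynomial.C coef * mvChebT n α := by
  simp [Finsupp.linearCombination_apply, MvPolynomial.smul_eq_C_mul]

theorem mvCheb1Norm_linearCombination (c : (Fin n → ℕ) →₀ ℝ) :
    mvCheb1Norm (Finsupp.linearCombination ℝ (mvChebT n) c) = c.sum fun _ a => |a| := by
  rw [mvCheb1Norm]
  convert csInf_singleton (c.sum fun _ a => |a|) using 1
  congr 1
  ext s
  simp only [Set.mem_ofPred_eq, Set.mem_singleton_iff, ← linearCombination_mvChebT]
  constructor
  · rintro ⟨e, he, rfl⟩
    rw [linearIndependent_mvChebT he]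
  · rintro rfl
    exact ⟨c, rfl, rfl⟩

theorem L1Bound.mvCheb1Norm_le {p : MvPolynomial (Fin n) ℝ} {s : ℝ}
    (h : L1Bound (mvChebT n) p s) : mvCheb1Norm p ≤ s := by
  obtain ⟨c, rfl, hs⟩ := h
  rwa [mvCheb1Norm_linearCombination]

theorem L1Bound.prod_aeval {P : Fin n → ℝ[X]} {s : Fin n → ℝ}
    (h : ∀ i, L1Bound chebT (P i) (s i)) :
    L1Bound (mvChebT n) (∏ i, aeval (MvPolynomial.X i) (P i)) (∏ i, s i) := by
  choose c hc hs using h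
  have e : ∏ i, aeval (MvPolynomial.X i : MvPolynomial (Fin n) ℝ) (P i) =
      ∑ α ∈ Fintype.piFinset fun i => (c i).support, (∏ i, c i (α i)) • mvChebT n α := by
    simp only [← hc, Finsupp.linearCombination_apply, Finsupp.sum, map_sum, map_smul]
    rw [Finset.prod_univ_sum]
    simp only [mvChebT, Finset.prod_smul]
  rw [e]
  refine (L1Bound.sum _ fun α _ => (L1Bound.basis α).smul _).mono ?_
  simp only [mul_one, Finset.abs_prod]
  rw [← Finset.prod_univ_sum (fun i => (c i).support) fun i k => |c i k|]
  exact Finset.prod_le_prod (fun i _ => Finset.sum_nonneg fun _ _ => abs_nonneg _) fun i _ => hs i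

/-- A polynomial of total degree at most `d` is a combination of the `T_α` with `∑ α ≤ d`. -/
theorem exists_mvChebT_expansion (f : MvPolynomial (Fin n) ℝ) {d : ℕ} (hf : f.totalDegree ≤ d) :
    ∃ c : (Fin n → ℕ) →₀ ℝ, Finsupp.linearCombination ℝ (mvChebT n) c = f ∧
      ∀ α ∈ c.support, ∑ i, α i ≤ d := by
  suffices h : f ∈ Submodule.span ℝ (mvChebT n '' {α | ∑ i, α i ≤ d}) by
    rw [Finsupp.mem_span_image_iff_linearCombination] at h
    obtain ⟨c, hc, rfl⟩ := h
    exact ⟨c, rfl, fun α hα => hc hα⟩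
  rw [f.as_sum]
  refine Submodule.sum_mem _ fun m hm => ?_
  have hmd : ∑ i, m i ≤ d := by
    have := (MvPolynomial.le_totalDegree hm).trans hf
    rwa [Finsupp.sum_fintype _ _ (fun _ => rfl)] at this
  rw [MvPolynomial.monomial_eq, ← MvPolynomial.smul_eq_C_mul]
  refine Submodule.smul_mem _ _ ?_
  rw [Finsupp.prod_fintype _ _ (fun _ => pow_zero _)]
  choose c hc using exists_chebT_expansion_X_pow
  have e : ∀ i, (MvPolynomial.X i : MvPolynomial (Fin n) ℝ) ^ m i =
      ∑ j ∈ Finset.range (m i + 1), c (m i) j • aeval (MvPolynomial.X i) (chebT j) := by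
    intro i
    have := congrArg (aeval (MvPolynomial.X i : MvPolynomial (Fin n) ℝ)) (hc (m i))
    simpa using this
  simp only [e]
  rw [Finset.prod_univ_sum]
  refine Submodule.sum_mem _ fun α hα => ?_
  rw [Finset.prod_smul]
  refine Submodule.smul_mem _ _ (Submodule.subset_span ⟨α, ?_, rfl⟩)
  rw [Fintype.mem_piFinset] at hα
  refine (Finset.sum_le_sum fun i _ => ?_).trans hmd
  have := Finset.mem_range.1 (hα i)
  omega

/-- Tensor products of univariate perturbations of Chebyshev polynomials. -/
theorem l1Bound_prod_sub_mvChebT {P : Fin n → ℝ[X]} {α : Fin n → ℕ} {ε : ℝ}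
    (h : ∀ i, L1Bound chebT (P i - chebT (α i)) ε) :
    L1Bound (mvChebT n) (∏ i, aeval (MvPolynomial.X i) (P i) - mvChebT n α)
      ((1 + ε) ^ n - 1) := by
  have e : ∏ i, aeval (MvPolynomial.X i : MvPolynomial (Fin n) ℝ) (P i) - mvChebT n α =
      ∑ t ∈ (Finset.univ : Finset (Fin n)).powerset.erase Finset.univ,
        ∏ i, aeval (MvPolynomial.X i)
          (if i ∈ t then chebT (α i) else P i - chebT (α i)) := by
    have h1 : ∀ i, aeval (MvPolynomial.X i : MvPolynomial (Fin n) ℝ) (P i) =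
      aeval (MvPolynomial.X i) (chebT (α i)) + aeval (MvPolynomial.X i) (P i - chebT (α i)) := by
      intro i; simp
    simp only [h1]
    rw [Finset.prod_add, ← Finset.add_sum_erase _ _ (Finset.mem_powerset_self Finset.univ)]
    simp only [Finset.sdiff_self, Finset.prod_empty, mul_one, mvChebT, add_sub_cancel_left]
    refine Finset.sum_congr rfl fun t _ => ?_
    rw [← Finset.prod_sdiff (Finset.subset_univ t), mul_comm]
    congr 1
    · exact Finset.prod_congr rfl fun i hi => by simp_all
    · exact Finset.prod_congr rfl fun i hi => by simp_all
  have e2 : (1 + ε) ^ n - 1 =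
      ∑ t ∈ (Finset.univ : Finset (Fin n)).powerset.erase Finset.univ,
        ∏ i, (if i ∈ t then 1 else ε) := by
    have : (1 + ε) ^ n = ∏ _i : Fin n, (1 + ε) := by simp
    rw [this, Finset.prod_add, ← Finset.add_sum_erase _ _ (Finset.mem_powerset_self Finset.univ)]
    simp only [Finset.sdiff_self, Finset.prod_empty, mul_one, Finset.prod_const_one, add_sub_cancel_left]
    refine Finset.sum_congr rfl fun t _ => ?_
    rw [Finset.prod_ite]
    simp [Finset.card_sdiff, Finset.filter_not]
  rw [e, e2]
  refine L1Bound.sum _ fun t _ => L1Bound.prod_aeval fun i => ?_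
  split_ifs
  · exact L1Bound.basis _
  · exact h i

end Multivariate

section SumsOfSquares

theorem IsSumSq.map_ringHom {R S : Type*} [Semiring R] [Semiring S] (g : R →+* S) {x : R}
    (hx : IsSumSq x) : IsSumSq (g x) := by
  induction hx with
  | zero => simp
  | sq_add a _ ih => simpa using IsSumSq.sq_add (g a) ih

theorem IsSumSq.algebraMap_mul {A : Type*} [CommRing A] [Algebra ℝ A] {w : ℝ} (hw : 0 ≤ w) {x : A}
    (hx : IsSumSq x) : IsSumSq (algebraMap ℝ A w * x) := by
  rw [← Real.mul_self_sqrt hw, map_mul]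
  exact (IsSumSq.mul_self _).mul hx

theorem IsSumSq.isSOS {n : ℕ} {p : MvPolynomial (Fin n) ℝ} (hp : IsSumSq p) : IsSOS p := by
  induction hp with
  | zero => exact ⟨0, Fin.elim0, by simp⟩
  | sq_add a _ ih =>
    obtain ⟨s, h, rfl⟩ := ih
    exact ⟨s + 1, Fin.cons a h, by simp [Fin.sum_univ_succ, sq]⟩

theorem T_two_mul (k : ℤ) : Chebyshev.T ℝ (2 * k) = 2 * Chebyshev.T ℝ k ^ 2 - 1 := by
  have := Chebyshev.T_mul_T ℝ k k
  rw [sub_self, Chebyshev.T_zero, ← two_mul] at this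
  linear_combination -this

theorem one_le_T_two_pow_eval {a : ℝ} (ha : 1 ≤ a) (l : ℕ) :
    1 ≤ (Chebyshev.T ℝ (2 ^ l)).eval a := by
  induction l with
  | zero => simpa using ha
  | succ l ih =>
    rw [pow_succ', T_two_mul]
    simp only [eval_sub, eval_mul, eval_pow, eval_ofNat, eval_one]
    nlinarith

/-- The polynomial `(a² - x²) (T_J(a) - T_J(x))`, for `J ≥ 2` a power of two, is a sum of squares:
both factors change sign exactly at `x = ± a`. -/
theorem isSumSq_sub_mul_T_sub {a : ℝ} (ha : 1 ≤ a) (l : ℕ) :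
    IsSumSq ((C (a ^ 2) - X ^ 2) *
      (C ((Chebyshev.T ℝ (2 ^ (l + 1))).eval a) - Chebyshev.T ℝ (2 ^ (l + 1)))) := by
  induction l with
  | zero =>
    have h := (IsSumSq.mul_self (C (a ^ 2) - X ^ 2 : ℝ[X])).algebraMap_mul (zero_le_two (α := ℝ))
    refine Eq.mp (congrArg IsSumSq ?_) h
    simp [Chebyshev.T_two]
    simp only [C_ofNat]
    ring
  | succ l ih =>
    set c := (Chebyshev.T ℝ (2 ^ (l + 1))).eval a with hc
    have hc1 : 1 ≤ c := one_le_T_two_pow_eval ha (l + 1)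
    have h1 : IsSumSq (C c + Chebyshev.T ℝ (2 ^ (l + 1))) := by
      have h := ((IsSumSq.one (R := ℝ[X])).algebraMap_mul (sub_nonneg.2 hc1)).add
        ((IsSumSq.mul_self (Chebyshev.T ℝ (2 ^ l))).algebraMap_mul (zero_le_two (α := ℝ)))
      refine Eq.mp (congrArg IsSumSq ?_) h
      rw [pow_succ', T_two_mul]
      simp only [algebraMap_eq, C_sub, C_1, C_ofNat]
      ring
    have h := (ih.mul h1).algebraMap_mul (zero_le_two (α := ℝ))
    refine Eq.mp (congrArg IsSumSq ?_) h
    rw [pow_succ' _ (l + 1), T_two_mul]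
    simp only [eval_sub, eval_mul, eval_pow, eval_ofNat, eval_one, ← hc, algebraMap_eq, C_sub, C_1,
      C_ofNat, C_mul, C_pow]
    ring

end SumsOfSquares

section Kernel

theorem T_mul_T_add_U_mul_U (a b : ℤ) :
    Chebyshev.T ℝ a * Chebyshev.T ℝ b +
      (1 - X ^ 2) * (Chebyshev.U ℝ (a - 1) * Chebyshev.U ℝ (b - 1)) = Chebyshev.T ℝ (a - b) := by
  refine eq_of_infinite_eval_eq _ _ ((Set.Icc_infinite (show (-1 : ℝ) < 1 by norm_num)).mono ?_)
  intro x hx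
  obtain ⟨θ, rfl⟩ : ∃ θ, Real.cos θ = x := ⟨Real.arccos x, Real.cos_arccos hx.1 hx.2⟩
  have ha := Chebyshev.U_real_cos θ (a - 1)
  have hb := Chebyshev.U_real_cos θ (b - 1)
  push_cast at ha hb
  rw [sub_add_cancel] at ha hb
  show eval _ _ = eval _ _
  simp only [eval_add, eval_mul, Chebyshev.T_real_cos, eval_sub, eval_one, eval_pow, eval_X]
  push_cast
  rw [sub_mul (a : ℝ), Real.cos_sub, ← ha, ← hb]
  linear_combination -(eval (Real.cos θ) (Chebyshev.U ℝ (a - 1)) *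
    eval (Real.cos θ) (Chebyshev.U ℝ (b - 1))) * (Real.sin_sq_add_cos_sq θ)

variable (q : ℕ → ℝ) (M : ℕ)

/-- The part of the kernel without the factor `1 - x²`. -/
noncomputable def kernelT (φ : ℝ) : ℝ[X] :=
  (∑ a ∈ Finset.range M, C (q a * Real.cos (a * φ)) * Chebyshev.T ℝ a) ^ 2 +
    (∑ a ∈ Finset.range M, C (q a * Real.sin (a * φ)) * Chebyshev.T ℝ a) ^ 2

/-- The cofactor of `1 - x²` in the kernel. -/
noncomputable def kernelU (φ : ℝ) : ℝ[X] :=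
  (∑ a ∈ Finset.range M, C (q a * Real.cos (a * φ)) * Chebyshev.U ℝ (a - 1)) ^ 2 +
    (∑ a ∈ Finset.range M, C (q a * Real.sin (a * φ)) * Chebyshev.U ℝ (a - 1)) ^ 2

/-- The autocorrelation of the weights `q 0, …, q (M - 1)`. -/
noncomputable def autocorr (k : ℕ) : ℝ :=
  ∑ a ∈ Finset.range M, ∑ b ∈ Finset.range M, if (k : ℤ) = a - b then q a * q b else 0

theorem kernelT_add_kernelU (φ : ℝ) :
    kernelT q M φ + (1 - X ^ 2) * kernelU q M φ =
      ∑ a ∈ Finset.range M, ∑ b ∈ Finset.range M,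
        (q a * q b * Real.cos (((a - b : ℤ) : ℝ) * φ)) • Chebyshev.T ℝ (a - b) := by
  simp only [kernelT, kernelU, sq]
  simp only [Finset.sum_mul_sum, ← Finset.sum_add_distrib]
  simp only [Finset.mul_sum, ← Finset.sum_add_distrib]
  refine Finset.sum_congr rfl fun a _ => Finset.sum_congr rfl fun b _ => ?_
  rw [← T_mul_T_add_U_mul_U, smul_eq_C_mul]
  push_cast
  rw [sub_mul (a : ℝ), Real.cos_sub]
  simp only [C_mul, C_add]
  ring

theorem sum_cos_smul_kernel (N k : ℕ) (hN : k + M ≤ N) :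
    ∑ i ∈ Finset.range N, Real.cos (k * equiAngle N i) •
      (kernelT q M (equiAngle N i) + (1 - X ^ 2) * kernelU q M (equiAngle N i)) =
      (N * autocorr q M k) • Chebyshev.T ℝ k := by
  simp only [kernelT_add_kernelU, Finset.smul_sum, smul_smul]
  rw [Finset.sum_comm]
  have h1 : ∀ a ∈ Finset.range M, ∑ i ∈ Finset.range N, ∑ b ∈ Finset.range M,
      (Real.cos (k * equiAngle N i) * (q a * q b * Real.cos (((a - b : ℤ) : ℝ) * equiAngle N i))) •
        Chebyshev.T ℝ (a - b) =
      ∑ b ∈ Finset.range M, ((N / 2 * if (k : ℤ) = a - b then q a * q b else 0) +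
        (N / 2 * if (k : ℤ) = b - a then q b * q a else 0)) • Chebyshev.T ℝ k := by
    intro a ha
    rw [Finset.sum_comm]
    refine Finset.sum_congr rfl fun b hb => ?_
    rw [Finset.mem_range] at ha hb
    rw [← Finset.sum_smul]
    simp only [mul_left_comm _ (q a * q b)]
    have := sum_cos_mul_cos_equiAngle N k (a - b) (by
      rw [Nat.abs_cast]; have : |(a : ℤ) - b| < M := by rw [abs_lt]; omega
      omega)
    push_cast at this ⊢
    rw [← Finset.mul_sum, this, neg_sub]
    by_cases h1 : (k : ℤ) = a - b
    · by_cases h2 : (k : ℤ) = b - a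
      · simp only [h1, if_true]
        rw [← h1, if_pos h2, if_pos (by omega)]
        congr 1
        ring
      · simp only [if_neg h2, if_pos h1]
        rw [h1]
        congr 1
        ring
    · by_cases h2 : (k : ℤ) = b - a
      · simp only [if_neg h1, if_pos h2]
        rw [h2, ← Chebyshev.T_neg, neg_sub]
        congr 1
        ring
      · simp [h1, h2]
  rw [Finset.sum_congr rfl h1]
  simp only [← Finset.sum_smul, Finset.sum_add_distrib]
  congr 1
  rw [Finset.sum_comm (f := fun a b : ℕ => (N / 2 : ℝ) * if (k : ℤ) = b - a then q b * q a else 0)]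
  simp only [← Finset.mul_sum]
  rw [autocorr]
  ring

theorem one_sub_cos_nat_mul_le (k : ℕ) (x : ℝ) :
    1 - Real.cos (k * x) ≤ k ^ 2 * (1 - Real.cos x) := by
  have hs : ∀ y : ℝ, |Real.sin (k * y)| ≤ k * |Real.sin y| := by
    intro y
    induction k with
    | zero => simp
    | succ k ih =>
      push_cast
      rw [add_mul, one_mul, Real.sin_add]
      refine (abs_add_le _ _).trans ?_
      rw [abs_mul, abs_mul]
      nlinarith [Real.abs_cos_le_one y, Real.abs_cos_le_one (k * y), abs_nonneg (Real.sin y),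
        abs_nonneg (Real.sin (k * y)), abs_nonneg (Real.cos y), abs_nonneg (Real.cos (k * y))]
  have e : ∀ z : ℝ, 1 - Real.cos z = 2 * |Real.sin (z / 2)| ^ 2 := by
    intro z
    have := Real.cos_sq_add_sin_sq (z / 2)
    have h2 := Real.cos_two_mul (z / 2)
    rw [show 2 * (z / 2) = z by ring] at h2
    rw [sq_abs]
    linarith
  rw [e, e, mul_div_assoc]
  have := pow_le_pow_left₀ (abs_nonneg _) (hs (x / 2)) 2
  rw [mul_pow] at this
  linarith

theorem kernelT_eval_nonneg (φ x : ℝ) : 0 ≤ (kernelT q M φ).eval x := by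
  simp only [kernelT, eval_add, eval_pow]
  positivity

theorem kernelU_eval_nonneg (φ x : ℝ) : 0 ≤ (kernelU q M φ).eval x := by
  simp only [kernelU, eval_add, eval_pow]
  positivity

theorem sum_cos_mul_kernelT_eval_one (N k : ℕ) (hN : k + M ≤ N) :
    ∑ i ∈ Finset.range N, Real.cos (k * equiAngle N i) * (kernelT q M (equiAngle N i)).eval 1 =
      N * autocorr q M k := by
  have := congrArg (eval 1) (sum_cos_smul_kernel q M N k hN)
  simpa [eval_finsetSum] using this

theorem autocorr_le (k : ℕ) : autocorr q M k ≤ autocorr q M 0 := by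
  have hk := sum_cos_mul_kernelT_eval_one q M (k + M + 1) k (by omega)
  have h0 := sum_cos_mul_kernelT_eval_one q M (k + M + 1) 0 (by omega)
  have hN : (0 : ℝ) < ((k + M + 1 : ℕ) : ℝ) := by positivity
  refine le_of_mul_le_mul_left ?_ hN
  rw [← hk, ← h0]
  refine Finset.sum_le_sum fun i _ => mul_le_mul_of_nonneg_right ?_ (kernelT_eval_nonneg _ _ _ _)
  simpa using Real.cos_le_one _

theorem autocorr_zero_sub_le (k : ℕ) :
    autocorr q M 0 - autocorr q M k ≤ k ^ 2 * (autocorr q M 0 - autocorr q M 1) := by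
  have hk := sum_cos_mul_kernelT_eval_one q M (k + M + 1) k (by omega)
  have h1 := sum_cos_mul_kernelT_eval_one q M (k + M + 1) 1 (by omega)
  have h0 := sum_cos_mul_kernelT_eval_one q M (k + M + 1) 0 (by omega)
  have hN : (0 : ℝ) < ((k + M + 1 : ℕ) : ℝ) := by positivity
  refine le_of_mul_le_mul_left ?_ hN
  rw [mul_left_comm, mul_sub, mul_sub, ← hk, ← h0, ← h1, ← Finset.sum_sub_distrib,
    ← Finset.sum_sub_distrib, Finset.mul_sum]
  refine Finset.sum_le_sum fun i _ => ?_
  have := mul_le_mul_of_nonneg_right (one_sub_cos_nat_mul_le k (equiAngle (k + M + 1) i))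
    (kernelT_eval_nonneg q M (equiAngle (k + M + 1) i) 1)
  simp only [Nat.cast_zero, zero_mul, Real.cos_zero, Nat.cast_one, one_mul]
  linarith

end Kernel

section ParabolicWeights

theorem sum_parabola_sq (M n : ℕ) :
    ∑ a ∈ Finset.range n, ((a : ℝ) * (M - a)) ^ 2 =
      M ^ 2 * ((n - 1) * n * (2 * n - 1) / 6) - 2 * M * (n * (n - 1) / 2) ^ 2 +
        n * (n - 1) * (2 * n - 1) * (3 * n ^ 2 - 3 * n - 1) / 30 := by
  induction n with
  | zero => simp
  | succ n ih =>
    rw [Finset.sum_range_succ, ih]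
    push_cast
    ring

theorem sum_parabola_mul_succ (M n : ℕ) :
    ∑ a ∈ Finset.range n, ((a + 1 : ℕ) : ℝ) * (M - (a + 1 : ℕ)) * ((a : ℝ) * (M - a)) =
      ∑ a ∈ Finset.range n, ((a : ℝ) * (M - a)) ^ 2 + ((n : ℝ) * (M - n)) ^ 2 / 2 -
        (n * (M - 1) ^ 2 - 2 * (M - 1) * n * (n - 1) + 2 * n * (n - 1) * (2 * n - 1) / 3) / 2 := by
  induction n with
  | zero => simp
  | succ n ih =>
    rw [Finset.sum_range_succ, Finset.sum_range_succ, ih]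
    push_cast
    ring

theorem autocorr_zero (q : ℕ → ℝ) (M : ℕ) :
    autocorr q M 0 = ∑ a ∈ Finset.range M, q a ^ 2 := by
  refine Finset.sum_congr rfl fun a ha => ?_
  rw [Finset.sum_eq_single_of_mem a ha, if_pos (by simp), sq]
  intro b _ hb
  rw [if_neg (by push_cast; omega)]

theorem autocorr_one (q : ℕ → ℝ) (M : ℕ) (hq : q M = 0) :
    autocorr q M 1 = ∑ a ∈ Finset.range M, q (a + 1) * q a := by
  rw [autocorr, Finset.sum_comm]
  refine Finset.sum_congr rfl fun b hb => ?_
  rw [Finset.mem_range] at hb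
  have : ∀ a ∈ Finset.range M, (if ((1 : ℕ) : ℤ) = a - b then q a * q b else 0) =
      if a = b + 1 then q (b + 1) * q b else 0 := by
    intro a _
    by_cases h : a = b + 1
    · rw [if_pos (by omega), if_pos h, h]
    · rw [if_neg (by omega), if_neg h]
  rw [Finset.sum_congr rfl this, Finset.sum_ite_eq']
  split_ifs with h
  · rfl
  · rw [show b + 1 = M by rw [Finset.mem_range] at h; omega, hq, zero_mul]

theorem autocorr_parabola_pos (M : ℕ) (hM : 2 ≤ M) :
    0 < autocorr (fun a => (a : ℝ) * (M - a)) M 0 := by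
  rw [autocorr_zero]
  refine Finset.sum_pos' (fun i _ => sq_nonneg _) ⟨1, by simp; omega, ?_⟩
  have : (2 : ℝ) ≤ M := by exact_mod_cast hM
  have : (0 : ℝ) < M - 1 := by linarith
  simp only [Nat.cast_one, one_mul]
  positivity

theorem autocorr_parabola (M : ℕ) :
    (M ^ 2 + 1 : ℝ) * (autocorr (fun a => (a : ℝ) * (M - a)) M 0 -
      autocorr (fun a => (a : ℝ) * (M - a)) M 1) =
      5 * autocorr (fun a => (a : ℝ) * (M - a)) M 0 := by
  rw [autocorr_one _ _ (by simp), autocorr_zero, sum_parabola_mul_succ, sum_parabola_sq]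
  ring

end ParabolicWeights

section UnivariateKernel

theorem natDegree_U_sub_one_le (a : ℕ) : (Chebyshev.U ℝ (a - 1)).natDegree ≤ a - 1 := by
  rcases a with _ | a
  · simp
  · simp

theorem natDegree_kernelT_le (q : ℕ → ℝ) (M : ℕ) (φ : ℝ) :
    (kernelT q M φ).natDegree ≤ 2 * (M - 1) := by
  have h : ∀ w : ℕ → ℝ, ((∑ a ∈ Finset.range M, C (w a) * Chebyshev.T ℝ a) ^ 2).natDegree ≤
      2 * (M - 1) := fun w => natDegree_pow_le_of_le 2 <|
    natDegree_sum_le_of_forall_le _ _ fun a ha => (natDegree_C_mul_le _ _).trans <| by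
      rw [Finset.mem_range] at ha
      simp only [Chebyshev.natDegree_T, Int.natAbs_natCast]
      omega
  exact natDegree_add_le_of_degree_le (h _) (h _)

theorem natDegree_kernelU_le (q : ℕ → ℝ) (M : ℕ) (φ : ℝ) :
    (kernelU q M φ).natDegree ≤ 2 * (M - 2) := by
  have h : ∀ w : ℕ → ℝ, ((∑ a ∈ Finset.range M, C (w a) * Chebyshev.U ℝ (a - 1)) ^ 2).natDegree ≤
      2 * (M - 2) := fun w => natDegree_pow_le_of_le 2 <|
    natDegree_sum_le_of_forall_le _ _ fun a ha => (natDegree_C_mul_le _ _).trans <| by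
      rw [Finset.mem_range] at ha
      exact (natDegree_U_sub_one_le a).trans (by omega)
  exact natDegree_add_le_of_degree_le (h _) (h _)

theorem isSumSq_kernelT_comp (q : ℕ → ℝ) (M : ℕ) (φ : ℝ) (P : ℝ[X]) :
    IsSumSq ((kernelT q M φ).comp P) := by
  rw [kernelT, add_comp, sq, sq, mul_comp, mul_comp]
  exact (IsSumSq.mul_self _).add (IsSumSq.mul_self _)

theorem isSumSq_kernelU_comp (q : ℕ → ℝ) (M : ℕ) (φ : ℝ) (P : ℝ[X]) :
    IsSumSq ((kernelU q M φ).comp P) := by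
  rw [kernelU, add_comp, sq, sq, mul_comp, mul_comp]
  exact (IsSumSq.mul_self _).add (IsSumSq.mul_self _)

theorem natDegree_comp_C_mul_X_le (P : ℝ[X]) (ρ : ℝ) :
    (P.comp (C ρ * X)).natDegree ≤ P.natDegree :=
  natDegree_comp_le.trans <| by
    simpa using Nat.mul_le_mul_left P.natDegree
      ((natDegree_C_mul_le ρ X).trans natDegree_X_le)

/-- A positive quadrature-type operator, with values that are globally sums of squares,
that nearly reproduces the Chebyshev polynomials of low degree. -/
theorem exists_univariate_kernel (m d M l : ℕ) (a : ℝ) (ha : 1 ≤ a) (hM : 2 ≤ M)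
    (hm : 2 * (M - 1) + 2 ^ (l + 1) ≤ m) (hd : 4 * (1 - a⁻¹) * (d : ℝ) ^ 2 ≤ 1) :
    ∃ (N : ℕ) (y : ℕ → ℝ) (G : ℕ → ℝ[X]), (∀ i, y i ∈ Set.Icc (-1 : ℝ) 1) ∧
      (∀ i, IsSumSq (G i)) ∧ (∀ i, (G i).natDegree ≤ m) ∧
      ∀ k ≤ d, L1Bound chebT (∑ i ∈ Finset.range N, (chebT k).eval (y i) • G i - chebT k)
        (10 * (d : ℝ) ^ 2 / (M ^ 2 + 1) + 4 * (1 - a⁻¹) * (d : ℝ) ^ 2 +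
          2 * (m + 1) / (Chebyshev.T ℝ (2 ^ (l + 1))).eval a) := by
  set ρ := a⁻¹ with hρdef
  have ha0 : 0 < a := by linarith
  have hρ1 : ρ ≤ 1 := inv_le_one_of_one_le₀ ha
  have hρ0 : 0 < ρ := inv_pos.2 ha0
  set J : ℤ := 2 ^ (l + 1) with hJ
  set c := (Chebyshev.T ℝ J).eval a with hc
  have hc1 : 1 ≤ c := one_le_T_two_pow_eval ha (l + 1)
  have hc0 : 0 < c := by linarith
  set q : ℕ → ℝ := fun a => (a : ℝ) * (M - a) with hq
  set c0 := autocorr q M 0 with hc0def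
  have hc0pos : 0 < c0 := autocorr_parabola_pos M hM
  set N := d + M with hN
  have hNpos : (0 : ℝ) < N := by rw [hN]; positivity
  set w : ℝ := (N * c0)⁻¹ with hw
  have hwpos : 0 < w := by positivity
  set L : ℝ[X] := C ρ * X with hL
  set S : ℝ[X] := (1 - L ^ 2) * (1 - C c⁻¹ * Chebyshev.T ℝ J) with hS
  set kT : ℕ → ℝ[X] := fun i => (kernelT q M (equiAngle N i)).comp L with hkT
  set kU : ℕ → ℝ[X] := fun i => (kernelU q M (equiAngle N i)).comp L with hkU
  have hSsq : IsSumSq S := by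
    have h := (isSumSq_sub_mul_T_sub ha l).algebraMap_mul (w := ρ ^ 2 * c⁻¹) (by positivity)
    refine Eq.mp (congrArg IsSumSq ?_) h
    rw [← hJ, ← hc, hS, hL]
    have e1 : (C ρ : ℝ[X]) * C a = 1 := by rw [← C_mul, hρdef, inv_mul_cancel₀ ha0.ne', C_1]
    have e2 : (C c⁻¹ : ℝ[X]) * C c = 1 := by rw [← C_mul, inv_mul_cancel₀ hc0.ne', C_1]
    simp only [algebraMap_eq, C_mul, C_pow]
    calc _ = ((C ρ * C a) ^ 2 - (C ρ * X) ^ 2) * (C c⁻¹ * C c - C c⁻¹ * Chebyshev.T ℝ J) := by ring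
      _ = _ := by rw [e1, e2]; ring
  have hJdeg : (Chebyshev.T ℝ J).natDegree = 2 ^ (l + 1) := by
    rw [Chebyshev.natDegree_T, hJ]
    simp [Int.natAbs_pow]
  have hLdeg : (1 - L ^ 2 : ℝ[X]).natDegree ≤ 2 := by
    refine (natDegree_sub_le_of_le natDegree_one.le (natDegree_pow_le_of_le (m := 1) 2
      ((natDegree_C_mul_le ρ X).trans natDegree_X_le))).trans (by simp)
  have hkTdeg : ∀ i, (kT i).natDegree ≤ 2 * (M - 1) := fun i =>
    (natDegree_comp_C_mul_X_le _ _).trans (natDegree_kernelT_le _ _ _)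
  have hkUdeg : ∀ i, (kU i).natDegree ≤ 2 * (M - 2) := fun i =>
    (natDegree_comp_C_mul_X_le _ _).trans (natDegree_kernelU_le _ _ _)
  have hTcdeg : (C c⁻¹ * Chebyshev.T ℝ J).natDegree ≤ 2 ^ (l + 1) :=
    (natDegree_C_mul_le _ _).trans hJdeg.le
  have hSdeg : S.natDegree ≤ 2 + 2 ^ (l + 1) :=
    natDegree_mul_le_of_le hLdeg ((natDegree_sub_le_of_le natDegree_one.le hTcdeg).trans (by simp))
  refine ⟨N, fun i => Real.cos (equiAngle N i), fun i => C w * (kT i + S * kU i),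
    fun i => ⟨Real.neg_one_le_cos _, Real.cos_le_one _⟩, fun i => ?_, fun i => ?_, fun k hk => ?_⟩
  · exact ((isSumSq_kernelT_comp _ _ _ _).add
      (hSsq.mul (isSumSq_kernelU_comp _ _ _ _))).algebraMap_mul hwpos.le
  · refine (natDegree_C_mul_le _ _).trans (natDegree_add_le_of_degree_le ?_ ?_)
    · exact (hkTdeg i).trans (by omega)
    · exact (natDegree_mul_le_of_le hSdeg (hkUdeg i)).trans (by omega)
  · have hkd : (k : ℝ) ≤ d := by exact_mod_cast hk
    simp only [chebT_eval_cos]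
    set E : ℝ[X] := C c⁻¹ * Chebyshev.T ℝ J * (1 - L ^ 2) *
      ∑ i ∈ Finset.range N, (w * Real.cos (k * equiAngle N i)) • kU i with hE
    have hquad : ∀ k ≤ d, ∑ i ∈ Finset.range N, (w * Real.cos (k * equiAngle N i)) •
        (kT i + (1 - L ^ 2) * kU i) =
        (autocorr q M k / c0) • (Chebyshev.T ℝ k).comp L := by
      intro k hk
      have h := congrArg (fun P : ℝ[X] => w • P.comp L) (sum_cos_smul_kernel q M N k (by omega))
      simp only [sum_comp, smul_comp, add_comp, mul_comp, sub_comp, one_comp, pow_comp,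
        X_comp, Finset.smul_sum, smul_smul] at h
      rw [h]
      congr 1
      rw [hw]
      field_simp
    have hdecomp : ∑ i ∈ Finset.range N, Real.cos (k * equiAngle N i) • (C w * (kT i + S * kU i)) =
        (autocorr q M k / c0) • (Chebyshev.T ℝ k).comp L - E := by
      rw [← hquad k hk, hE, Finset.mul_sum, ← Finset.sum_sub_distrib]
      refine Finset.sum_congr rfl fun i _ => ?_
      simp only [smul_eq_C_mul, C_mul, hS]
      ring
    have hEdeg : E.natDegree ≤ m := by
      refine (natDegree_mul_le_of_le (natDegree_mul_le_of_le hTcdeg hLdeg)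
        (natDegree_sum_le_of_forall_le (n := 2 * (M - 2)) _ _ fun i _ => ?_)).trans (by omega)
      exact (natDegree_smul_le _ _).trans (hkUdeg i)
    have hEeval : ∀ θ : ℝ, |E.eval (Real.cos θ)| ≤ c⁻¹ := by
      intro θ
      set x := Real.cos θ with hx
      have hx2 : (ρ * x) ^ 2 ≤ 1 := by
        rw [mul_pow]
        have h1 : ρ ^ 2 ≤ 1 := pow_le_one₀ hρ0.le hρ1
        have h2 : x ^ 2 ≤ 1 := Real.cos_sq_le_one θ
        nlinarith [sq_nonneg ρ, sq_nonneg x]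
      have hU0 : ∀ i, 0 ≤ (kU i).eval x := fun i => by
        simp only [hkU, eval_comp]; exact kernelU_eval_nonneg _ _ _ _
      have hT0 : ∀ i, 0 ≤ (kT i).eval x := fun i => by
        simp only [hkT, eval_comp]; exact kernelT_eval_nonneg _ _ _ _
      have h0 := congrArg (eval x) (hquad 0 (Nat.zero_le d))
      simp only [eval_finsetSum, eval_smul, Nat.cast_zero, zero_mul, Real.cos_zero, mul_one,
        smul_eq_mul, eval_add, eval_mul, Chebyshev.T_zero, one_comp, eval_one, eval_sub, eval_pow,
        ← hc0def, div_self hc0pos.ne'] at h0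
      have hLx : L.eval x = ρ * x := by simp [hL]
      rw [hLx] at h0
      have hsum : |(1 - (ρ * x) ^ 2) * ∑ i ∈ Finset.range N,
          w * Real.cos (k * equiAngle N i) * (kU i).eval x| ≤ 1 := by
        rw [Finset.mul_sum]
        refine (Finset.abs_sum_le_sum_abs _ _).trans
          ((Finset.sum_le_sum fun i _ => ?_).trans h0.le)
        rw [abs_mul, abs_mul, abs_mul, abs_of_nonneg (sub_nonneg.2 hx2), abs_of_pos hwpos,
          abs_of_nonneg (hU0 i)]
        have hcos := Real.abs_cos_le_one (k * equiAngle N i)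
        have hnn : 0 ≤ w * ((1 - (ρ * x) ^ 2) * (kU i).eval x) :=
          mul_nonneg hwpos.le (mul_nonneg (sub_nonneg.2 hx2) (hU0 i))
        have := mul_le_mul_of_nonneg_left hcos hnn
        have := mul_nonneg hwpos.le (hT0 i)
        linarith
      simp only [hE, eval_mul, eval_finsetSum, eval_smul, smul_eq_mul, eval_C, eval_sub, eval_one,
        eval_pow, hLx]
      rw [mul_assoc, abs_mul, abs_mul, abs_of_pos (inv_pos.2 hc0), hx, Chebyshev.T_real_cos, ← hx]
      calc _ ≤ c⁻¹ * 1 * 1 := by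
            gcongr
            exact Real.abs_cos_le_one _
        _ = c⁻¹ := by ring
    have hE1 := l1Bound_of_abs_eval_le E hEdeg hEeval
    have hkk : 4 * (1 - ρ) * (k : ℝ) ^ 2 ≤ 4 * (1 - ρ) * (d : ℝ) ^ 2 := by
      have : 0 ≤ 1 - ρ := by linarith
      gcongr
    have hdil := l1Bound_dilate hρ1 k (hkk.trans hd)
    have hTk2 : L1Bound chebT ((Chebyshev.T ℝ k).comp L) 2 :=
      (hdil.add (l1Bound_T k)).congr (by rw [sub_add_cancel]) (by linarith)
    have hcorr : |autocorr q M k / c0 - 1| ≤ 5 * (d : ℝ) ^ 2 / (M ^ 2 + 1) := by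
      have h1 := autocorr_le q M k
      have h2 := autocorr_zero_sub_le q M k
      have h3 := autocorr_parabola M
      rw [← hq] at h3
      rw [abs_sub_comm, abs_of_nonneg (sub_nonneg.2 ((div_le_one hc0pos).2 h1)),
        one_sub_div hc0pos.ne', div_le_div_iff₀ hc0pos (by positivity)]
      calc (c0 - autocorr q M k) * ((M : ℝ) ^ 2 + 1)
          ≤ k ^ 2 * (c0 - autocorr q M 1) * ((M : ℝ) ^ 2 + 1) := by gcongr
        _ = k ^ 2 * (((M : ℝ) ^ 2 + 1) * (c0 - autocorr q M 1)) := by ring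
        _ = k ^ 2 * (5 * c0) := by rw [h3]
        _ ≤ d ^ 2 * (5 * c0) := by gcongr
        _ = _ := by ring
    have hmain := (hTk2.smul (autocorr q M k / c0 - 1)).add (hdil.sub hE1)
    refine hmain.congr ?_ ?_
    · rw [hdecomp, sub_smul, one_smul, chebT]
      ring
    · have : 2 * ((m : ℝ) + 1) * c⁻¹ = 2 * (m + 1) / c := by rw [div_eq_mul_inv]
      have : 10 * (d : ℝ) ^ 2 / (M ^ 2 + 1) = 5 * (d : ℝ) ^ 2 / (M ^ 2 + 1) * 2 := by ring
      linarith

end UnivariateKernel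

section TensorKernel

theorem totalDegree_aeval_X_le {σ : Type*} (i : σ) (P : ℝ[X]) :
    (aeval (MvPolynomial.X i : MvPolynomial σ ℝ) P).totalDegree ≤ P.natDegree := by
  rw [aeval_eq_sum_range]
  refine MvPolynomial.totalDegree_finsetSum_le fun k hk => ?_
  refine (MvPolynomial.totalDegree_smul_le _ _).trans ((MvPolynomial.totalDegree_pow _ _).trans ?_)
  rw [MvPolynomial.totalDegree_X, mul_one]
  exact Nat.lt_succ_iff.1 (Finset.mem_range.1 hk)

variable {n : ℕ}

/-- The tensor product of the positive operators `g ↦ ∑ i < N, g (y i) • G i`. -/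
noncomputable def tensorKernel (n N : ℕ) (y : ℕ → ℝ) (G : ℕ → ℝ[X]) :
    MvPolynomial (Fin n) ℝ →ₗ[ℝ] MvPolynomial (Fin n) ℝ :=
  ∑ ν : Fin n → Fin N, ((MvPolynomial.aeval fun j => y (ν j)).toLinearMap.smulRight
    (∏ j, aeval (MvPolynomial.X j : MvPolynomial (Fin n) ℝ) (G (ν j))))

theorem tensorKernel_apply (N : ℕ) (y : ℕ → ℝ) (G : ℕ → ℝ[X]) (g : MvPolynomial (Fin n) ℝ) :
    tensorKernel n N y G g = ∑ ν : Fin n → Fin N, MvPolynomial.eval (fun j => y (ν j)) g •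
      ∏ j, aeval (MvPolynomial.X j : MvPolynomial (Fin n) ℝ) (G (ν j)) := by
  simp [tensorKernel, MvPolynomial.aeval_eq_eval]

theorem tensorKernel_mvChebT (N : ℕ) (y : ℕ → ℝ) (G : ℕ → ℝ[X]) (α : Fin n → ℕ) :
    tensorKernel n N y G (mvChebT n α) = ∏ j, aeval (MvPolynomial.X j)
      (∑ i ∈ Finset.range N, (chebT (α j)).eval (y i) • G i) := by
  simp only [tensorKernel_apply, eval_mvChebT, map_sum, map_smul, ← Fin.sum_univ_eq_sum_range
    (fun i => (chebT _).eval (y i) • aeval (MvPolynomial.X _ : MvPolynomial (Fin n) ℝ) (G i)),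
    Finset.prod_univ_sum, Fintype.piFinset_univ, Finset.prod_smul]

theorem isSOS_tensorKernel {N : ℕ} {y : ℕ → ℝ} {G : ℕ → ℝ[X]} {f : MvPolynomial (Fin n) ℝ}
    (hf : ∀ x : Fin n → ℝ, (∀ i, x i ∈ Set.Icc (-1 : ℝ) 1) → 0 ≤ MvPolynomial.eval x f)
    (hy : ∀ i, y i ∈ Set.Icc (-1 : ℝ) 1) (hG : ∀ i, IsSumSq (G i)) :
    IsSOS (tensorKernel n N y G f) := by
  rw [tensorKernel_apply]
  refine (IsSumSq.sum fun ν _ => ?_).isSOS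
  rw [Algebra.smul_def]
  exact (IsSumSq.prod fun j _ => (hG _).map_ringHom
    (aeval (MvPolynomial.X j : MvPolynomial (Fin n) ℝ)).toRingHom).algebraMap_mul
      (hf _ fun _ => hy _)

theorem totalDegree_tensorKernel_le (N : ℕ) (y : ℕ → ℝ) {G : ℕ → ℝ[X]} {m : ℕ}
    (hG : ∀ i, (G i).natDegree ≤ m) (f : MvPolynomial (Fin n) ℝ) :
    (tensorKernel n N y G f).totalDegree ≤ n * m := by
  rw [tensorKernel_apply]
  refine MvPolynomial.totalDegree_finsetSum_le fun ν _ => ?_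
  refine (MvPolynomial.totalDegree_smul_le _ _).trans
    ((MvPolynomial.totalDegree_finsetProd _ _).trans ?_)
  refine (Finset.sum_le_card_nsmul _ _ m fun j _ =>
    (totalDegree_aeval_X_le _ _).trans (hG _)).trans ?_
  simp

theorem mvCheb1Norm_tensorKernel_sub_le {d N : ℕ} {y : ℕ → ℝ} {G : ℕ → ℝ[X]} {ε : ℝ}
    (h : ∀ k ≤ d, L1Bound chebT
      (∑ i ∈ Finset.range N, (chebT k).eval (y i) • G i - chebT k) ε)
    {f : MvPolynomial (Fin n) ℝ} (hf : f.totalDegree ≤ d) :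
    mvCheb1Norm (tensorKernel n N y G f - f) ≤ mvCheb1Norm f * ((1 + ε) ^ n - 1) := by
  obtain ⟨c, rfl, hc⟩ := exists_mvChebT_expansion f hf
  rw [mvCheb1Norm_linearCombination]
  refine L1Bound.mvCheb1Norm_le ?_
  have key : L1Bound (mvChebT n) (∑ α ∈ c.support,
      c α • (tensorKernel n N y G (mvChebT n α) - mvChebT n α))
      (∑ α ∈ c.support, |c α| * ((1 + ε) ^ n - 1)) := by
    refine L1Bound.sum _ fun α hα => L1Bound.smul _ ?_
    rw [tensorKernel_mvChebT]
    exact l1Bound_prod_sub_mvChebT fun i => h _ <|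
      (Finset.single_le_sum (fun _ _ => Nat.zero_le _) (Finset.mem_univ i)).trans (hc α hα)
  refine key.congr ?_ (by rw [Finsupp.sum, Finset.sum_mul])
  simp only [smul_sub, Finset.sum_sub_distrib, Finsupp.linearCombination_apply, Finsupp.sum,
    map_sum, map_smul]

end TensorKernel

section Parameters

theorem one_add_pow_sub_one_le {n : ℕ} {ε : ℝ} (hε : 0 ≤ ε) (h : n * ε ≤ 1) :
    (1 + ε) ^ n - 1 ≤ 2 * (n * ε) := by
  have h1 : (1 + ε) ^ n ≤ Real.exp (n * ε) := by
    rw [Real.exp_nat_mul]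
    exact pow_le_pow_left₀ (by linarith) (by linarith [Real.add_one_le_exp ε]) n
  have h0 : 0 ≤ n * ε := by positivity
  have h2 := Real.abs_exp_sub_one_le (x := n * ε) (by rwa [abs_of_nonneg h0])
  rw [abs_of_nonneg h0] at h2
  linarith [le_abs_self (Real.exp (n * ε) - 1)]

theorem cosh_sub_one_le_sq {t : ℝ} (h : t ^ 2 ≤ 1) : Real.cosh t - 1 ≤ t ^ 2 := by
  have h1 := Real.cosh_le_exp_half_sq t
  have h2 := Real.abs_exp_sub_one_le (x := t ^ 2 / 2)
    (by rw [abs_of_nonneg (by positivity)]; linarith)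
  rw [abs_of_nonneg (a := t ^ 2 / 2) (by positivity)] at h2
  linarith [le_abs_self (Real.exp (t ^ 2 / 2) - 1)]

end Parameters

section Main

theorem exists_univariate_kernel_of_le_exp {m d : ℕ} {L : ℝ} (hd : 1 ≤ d) (hL : 1 ≤ L)
    (hm : 540 * (d : ℝ) ^ 2 * L ≤ m) (hmL : (m : ℝ) ≤ Real.exp L) :
    ∃ (N : ℕ) (y : ℕ → ℝ) (G : ℕ → ℝ[X]), (∀ i, y i ∈ Set.Icc (-1 : ℝ) 1) ∧
      (∀ i, IsSumSq (G i)) ∧ (∀ i, (G i).natDegree ≤ m) ∧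
      ∀ k ≤ d, L1Bound chebT (∑ i ∈ Finset.range N, (chebT k).eval (y i) • G i - chebT k)
        (4500 * (d : ℝ) ^ 2 * L ^ 2 / m ^ 2) := by
  have hd1 : (1 : ℝ) ≤ d := by exact_mod_cast hd
  have hd2 : (1 : ℝ) ≤ (d : ℝ) ^ 2 := one_le_pow₀ hd1
  have hdL : (d : ℝ) ^ 2 ≤ (d : ℝ) ^ 2 * L := le_mul_of_one_le_right (by positivity) hL
  have hm540 : (540 : ℝ) ≤ m := by linarith
  have hm540' : 540 ≤ m := by exact_mod_cast hm540
  have hm0 : (0 : ℝ) < m := by linarith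
  have hLm : 540 * L ≤ m := by nlinarith
  obtain ⟨l, hl⟩ : ∃ l, Nat.log 2 (m / 4) = l + 1 :=
    Nat.exists_eq_add_of_le' (Nat.log_pos one_lt_two (by omega))
  have hJM : 2 ^ (l + 1) ≤ m / 4 := hl ▸ Nat.pow_log_le_self 2 (by omega)
  have hMJ : m / 4 < 2 ^ (l + 1 + 1) := hl ▸ Nat.lt_pow_succ_log_self one_lt_two _
  have hJm : (m : ℝ) ≤ 8 * 2 ^ (l + 1) := by
    have : m ≤ 8 * 2 ^ (l + 1) := by rw [pow_succ] at hMJ; omega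
    exact_mod_cast this
  have hMm : (m : ℝ) ≤ 5 * (m / 4 : ℕ) := by
    have : m ≤ 5 * (m / 4) := by omega
    exact_mod_cast this
  set t : ℝ := 32 * L / m with ht
  have ht0 : 0 ≤ t := by positivity
  have ht1 : t ≤ 1 := by rw [ht, div_le_one hm0]; linarith
  have ha1 : 1 - (Real.cosh t)⁻¹ ≤ t ^ 2 := by
    have h1 := cosh_sub_one_le_sq (pow_le_one₀ (n := 2) ht0 ht1)
    have h2 := Real.cosh_pos t
    have h3 : 2 - Real.cosh t ≤ (Real.cosh t)⁻¹ := by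
      rw [← one_div, le_div_iff₀ h2]
      nlinarith [sq_nonneg (Real.cosh t - 1)]
    linarith
  have hdt : 4 * (1 - (Real.cosh t)⁻¹) * (d : ℝ) ^ 2 ≤ 4096 * (d : ℝ) ^ 2 * L ^ 2 / m ^ 2 := by
    calc 4 * (1 - (Real.cosh t)⁻¹) * (d : ℝ) ^ 2 ≤ 4 * t ^ 2 * (d : ℝ) ^ 2 := by gcongr
      _ = _ := by rw [ht]; ring
  have hsmall : 4096 * (d : ℝ) ^ 2 * L ^ 2 / m ^ 2 ≤ 1 := by
    rw [div_le_one (by positivity)]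
    calc (4096 : ℝ) * (d : ℝ) ^ 2 * L ^ 2 ≤ (540 * (d : ℝ) ^ 2 * L) * (540 * L) := by
          have : 0 ≤ (d : ℝ) ^ 2 * L ^ 2 := by positivity
          linarith
      _ ≤ (m : ℝ) * m := by gcongr
      _ = (m : ℝ) ^ 2 := by ring
  have hT : (m : ℝ) ^ 4 / 2 ≤ (Chebyshev.T ℝ (2 ^ (l + 1))).eval (Real.cosh t) := by
    rw [Chebyshev.T_real_cosh, Real.cosh_eq]
    push_cast
    have h4 : 4 * L ≤ 2 ^ (l + 1) * t := by
      rw [ht, mul_div_assoc', le_div_iff₀ hm0]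
      nlinarith
    have : (m : ℝ) ^ 4 ≤ Real.exp (2 ^ (l + 1) * t) := by
      calc (m : ℝ) ^ 4 ≤ Real.exp L ^ 4 := by gcongr
        _ = Real.exp (4 * L) := by rw [← Real.exp_nat_mul]; norm_num
        _ ≤ _ := Real.exp_le_exp.2 h4
    linarith [Real.exp_pos (-(2 ^ (l + 1) * t))]
  obtain ⟨N, y, G, hy, hG, hGm, h⟩ := exists_univariate_kernel m d (m / 4) l (Real.cosh t)
    (Real.one_le_cosh t) (by omega) (by omega) (hdt.trans hsmall)
  refine ⟨N, y, G, hy, hG, hGm, fun k hk => (h k hk).mono ?_⟩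
  have e1 : 10 * (d : ℝ) ^ 2 / (((m / 4 : ℕ) : ℝ) ^ 2 + 1) ≤ 250 * (d : ℝ) ^ 2 * L ^ 2 / m ^ 2 := by
    rw [div_le_div_iff₀ (by positivity) (by positivity)]
    have h1 : (m : ℝ) ^ 2 ≤ 25 * (((m / 4 : ℕ) : ℝ) ^ 2 + 1) := by nlinarith
    have h2 : (1 : ℝ) ≤ L ^ 2 := one_le_pow₀ hL
    calc 10 * (d : ℝ) ^ 2 * m ^ 2 ≤ 10 * (d : ℝ) ^ 2 * (25 * (((m / 4 : ℕ) : ℝ) ^ 2 + 1)) := by gcongr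
      _ = 250 * (d : ℝ) ^ 2 * 1 * (((m / 4 : ℕ) : ℝ) ^ 2 + 1) := by ring
      _ ≤ _ := by gcongr
  have e2 : 2 * ((m : ℝ) + 1) / (Chebyshev.T ℝ (2 ^ (l + 1))).eval (Real.cosh t) ≤
      (d : ℝ) ^ 2 * L ^ 2 / m ^ 2 := by
    calc _ ≤ 2 * ((m : ℝ) + 1) / (m ^ 4 / 2) := by gcongr
      _ ≤ 1 / m ^ 2 := by
        rw [div_le_div_iff₀ (by positivity) (by positivity)]
        have : 4 * ((m : ℝ) + 1) ≤ m ^ 2 := by nlinarith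
        nlinarith [mul_le_mul_of_nonneg_right this (sq_nonneg (m : ℝ))]
      _ ≤ _ := by
        gcongr
        exact one_le_mul_of_one_le_of_one_le hd2 (one_le_pow₀ hL)
  calc _ ≤ 250 * (d : ℝ) ^ 2 * L ^ 2 / m ^ 2 + 4096 * (d : ℝ) ^ 2 * L ^ 2 / m ^ 2 +
        (d : ℝ) ^ 2 * L ^ 2 / m ^ 2 := by gcongr
    _ = 4347 * (d : ℝ) ^ 2 * L ^ 2 / m ^ 2 := by ring
    _ ≤ _ := by gcongr; norm_num

theorem mvCheb1Norm_nonneg {n : ℕ} (f : MvPolynomial (Fin n) ℝ) : 0 ≤ mvCheb1Norm f := by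
  refine Real.sInf_nonneg ?_
  rintro s ⟨c, -, rfl⟩
  exact Finset.sum_nonneg fun _ _ => abs_nonneg _

theorem one_le_logb_of_le_div {r : ℕ} {K : ℝ} (hr : 0 < r) (hK : 1 ≤ K)
    (h : K ≤ r / Real.logb 2 r) : 1 ≤ Real.logb 2 r := by
  have hr2 : 2 ≤ r := by
    by_contra! hlt
    obtain rfl : r = 1 := by omega
    norm_num at h
    linarith
  rw [Real.le_logb_iff_rpow_le one_lt_two (by positivity), Real.rpow_one]
  exact_mod_cast hr2

theorem le_exp_logb_two {r : ℕ} (hr : 0 < r) : (r : ℝ) ≤ Real.exp (Real.logb 2 r) := by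
  rw [← Real.log_le_iff_le_exp (by positivity), ← Real.log_div_log]
  exact le_div_self (Real.log_natCast_nonneg r) (Real.log_pos one_lt_two)
    (by linarith [Real.log_two_lt_d9])

end Main

/-- main theorem: SOS approximation of polynomials nonnegative on the
hypercube, with error `O(log³ r / r²)` in the Chebyshev 1-norm. -/
theorem sos_approximation_hypercube (n d : ℕ) (hn : 1 ≤ n) (hd : 1 ≤ d)
    (f : MvPolynomial (Fin n) ℝ) (hdeg : f.totalDegree ≤ d)
    (hf : ∀ x : Fin n → ℝ, (∀ i, x i ∈ Set.Icc (-1 : ℝ) 1) → 0 ≤ MvPolynomial.eval x f)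
    (r : ℕ) (hrpos : 0 < r) (hdvd : n ∣ r)
    (hr : 540 * (n : ℝ) ^ 2 * (d : ℝ) ^ 2 ≤ (r : ℝ) / Real.logb 2 r) :
    ∃ p : MvPolynomial (Fin n) ℝ, IsSOS p ∧ p.totalDegree ≤ r ∧
      mvCheb1Norm (p - f) ≤
        70458 * (n : ℝ) ^ 3 * (d : ℝ) ^ 2 * mvCheb1Norm f * (Real.logb 2 r) ^ 3 / (r : ℝ) ^ 2 := by
  have hn1 : (1 : ℝ) ≤ n := by exact_mod_cast hn
  have hd1 : (1 : ℝ) ≤ d := by exact_mod_cast hd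
  have hnd : (1 : ℝ) ≤ (n : ℝ) ^ 2 * (d : ℝ) ^ 2 :=
    one_le_mul_of_one_le_of_one_le (one_le_pow₀ hn1) (one_le_pow₀ hd1)
  have hL := one_le_logb_of_le_div hrpos (by linarith) hr
  have hexp := le_exp_logb_two hrpos
  set L := Real.logb 2 r
  rw [le_div_iff₀ (by linarith)] at hr
  obtain ⟨m, rfl⟩ := hdvd
  have hm1 : (1 : ℝ) ≤ m := by exact_mod_cast Nat.pos_of_mul_pos_left hrpos
  push_cast at hr hexp ⊢
  have hm : 540 * (n : ℝ) * (d : ℝ) ^ 2 * L ≤ m := by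
    refine le_of_mul_le_mul_left ?_ (zero_lt_one.trans_le hn1)
    linarith
  have hm' : 540 * (d : ℝ) ^ 2 * L ≤ m := by
    refine le_trans ?_ hm
    have : 540 * (d : ℝ) ^ 2 * L * 1 ≤ 540 * (d : ℝ) ^ 2 * L * n := by gcongr
    linarith
  obtain ⟨N, y, G, hy, hG, hGm, h⟩ := exists_univariate_kernel_of_le_exp hd hL hm'
    ((le_mul_of_one_le_left (by positivity) hn1).trans hexp)
  refine ⟨tensorKernel n N y G f, isSOS_tensorKernel hf hy hG,
    totalDegree_tensorKernel_le N y hGm f, (mvCheb1Norm_tensorKernel_sub_le h hdeg).trans ?_⟩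
  set ε := 4500 * (d : ℝ) ^ 2 * L ^ 2 / m ^ 2 with hε
  have hnε : n * ε ≤ 1 := by
    rw [hε, mul_div_assoc', div_le_one (by positivity)]
    calc n * (4500 * (d : ℝ) ^ 2 * L ^ 2) ≤ (540 * n * (d : ℝ) ^ 2 * L) * (540 * 1 * 1 * L) := by
          have : 0 ≤ n * (d : ℝ) ^ 2 * L ^ 2 := by positivity
          linarith
      _ ≤ (540 * n * (d : ℝ) ^ 2 * L) * (540 * n * (d : ℝ) ^ 2 * L) := by
          gcongr
          exact one_le_pow₀ hd1
      _ ≤ m * m := by gcongr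
      _ = _ := by ring
  have hF := mvCheb1Norm_nonneg f
  calc mvCheb1Norm f * ((1 + ε) ^ n - 1) ≤ mvCheb1Norm f * (2 * (n * ε)) := by
        gcongr
        exact one_add_pow_sub_one_le (by positivity) hnε
    _ = 9000 * (n : ℝ) ^ 3 * (d : ℝ) ^ 2 * mvCheb1Norm f * L ^ 2 / (n * m) ^ 2 := by
        rw [hε]
        field_simp
        ring
    _ ≤ _ := by
        gcongr
        · norm_num
        · norm_num
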